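/- arXiv:2103.02471 — 2 statements merged into one kernel-verified Lean document; each statement's English description precedes it below -/
import Mathlib

section
/- Let R be an integral domain, m a positive integer whose image in R is invertible, assume R contains a primitive m-th root of unity, and let A be a finite commutative group satisfying a^m = 1 for all a ∈ A. Then the R-algebra homomorphism (the Fourier transform) F : R[A] → ∏_{χ} R, where the product ranges over all group homomorphisms χ : A → Rˣ and where F([a])(χ) = χ(a) for a ∈ A, is bijective. -/
/-- The unnormalised inverse Fourier transform, `f ↦ ∑ a, (∑ χ, f χ * χ(a)⁻¹) [a]`. -/
noncomputable def fourierAdjoint (R A : Type*) [CommRing R] [CommGroup A] [Fintype A]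
    [Fintype (A →* Rˣ)] : ((A →* Rˣ) → R) →ₗ[R] MonoidAlgebra R A :=
  ∑ a : A, ∑ χ : A →* Rˣ,
    (LinearMap.proj χ : ((A →* Rˣ) → R) →ₗ[R] R).smulRight
      (((χ a)⁻¹ : Rˣ).val • MonoidAlgebra.of R A a)

theorem fourierAdjoint_apply {R A : Type*} [CommRing R] [CommGroup A] [Fintype A]
    [Fintype (A →* Rˣ)] (f : (A →* Rˣ) → R) :
    fourierAdjoint R A f =
      ∑ a : A, ∑ χ : A →* Rˣ, f χ • ((χ a)⁻¹ : Rˣ).val • MonoidAlgebra.of R A a := by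
  simp only [fourierAdjoint, LinearMap.sum_apply, LinearMap.smulRight_apply, LinearMap.proj_apply]

theorem sum_char_mul_inv_char {R A : Type*} [CommRing R] [IsDomain R] [CommGroup A] [Fintype A]
    [DecidableEq (A →* Rˣ)] (ψ χ : A →* Rˣ) :
    ∑ a : A, ((ψ a : R) * ((χ a)⁻¹ : Rˣ).val) = if χ = ψ then (Fintype.card A : R) else 0 := by
  classical
  have h := sum_hom_units ((Units.coeHom R).comp (ψ * χ⁻¹))
  have hiff : (Units.coeHom R).comp (ψ * χ⁻¹) = 1 ↔ χ = ψ := by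
    rw [eq_comm (a := χ), ← mul_inv_eq_one (a := ψ)]
    simp [MonoidHom.ext_iff, Units.ext_iff]
  simp only [hiff] at h
  simpa using h

theorem sum_char_apply_mul_inv {R A : Type*} [CommRing R] [IsDomain R] [CommGroup A] [Finite A]
    [HasEnoughRootsOfUnity R (Monoid.exponent A)] [Fintype (A →* Rˣ)] [DecidableEq A] (a b : A) :
    ∑ χ : A →* Rˣ, ((χ b : R) * ((χ a)⁻¹ : Rˣ).val) = if a = b then (Nat.card A : R) else 0 := by
  classical
  have h := sum_hom_units ((Units.coeHom R).comp (MonoidHom.eval (N := Rˣ) (b * a⁻¹)))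
  have hiff : (Units.coeHom R).comp (MonoidHom.eval (N := Rˣ) (b * a⁻¹)) = 1 ↔ a = b := by
    rw [eq_comm (a := a), ← CommGroup.forall_apply_eq_apply_iff A (M := R)]
    simp [MonoidHom.ext_iff, ← Units.ext_iff, Units.mul_inv_eq_one]
  rw [← CommGroup.card_monoidHom_of_hasEnoughRootsOfUnity A R, Nat.card_eq_fintype_card]
  simp only [hiff] at h
  simpa using h

theorem isUnit_natCard_of_pow_eq_one {R A : Type*} [CommRing R] [CommGroup A] [Finite A] {m : ℕ}
    (hu : IsUnit (m : R)) (hA : ∀ a : A, a ^ m = 1) : IsUnit (Nat.card A : R) := by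
  have hdvd : Nat.card A ∣ m ^ Group.rank A := card_dvd_exponent_pow_rank' A hA
  refine isUnit_of_dvd_unit (Nat.cast_dvd_cast (α := R) hdvd) ?_
  rw [Nat.cast_pow]
  exact hu.pow _


/-- The Fourier transform: if `R` is a domain in which `m` is invertible, containing a primitive
`m`-th root of unity, and `A` is a finite commutative group of exponent dividing `m`, then the
`R`-algebra map `R[A] → ∏_{χ : A →* Rˣ} R`, `[a] ↦ (χ(a))_χ`, is bijective. -/
theorem group_algebra_fourier_transform_bijective
    {R : Type*} [CommRing R] [IsDomain R] (m : ℕ) (hm : 0 < m)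
    (hu : IsUnit (m : R)) (ζ : R) (hζ : IsPrimitiveRoot ζ m)
    (A : Type*) [CommGroup A] [Fintype A] (hA : ∀ a : A, a ^ m = 1)
    (F : MonoidAlgebra R A →ₐ[R] ((A →* Rˣ) → R))
    (hF : ∀ (a : A) (χ : A →* Rˣ), F (MonoidAlgebra.of R A a) χ = (χ a : R)) :
    Function.Bijective F := by
  classical
  have : NeZero m := ⟨hm.ne'⟩
  have : HasEnoughRootsOfUnity R m := ⟨⟨ζ, hζ⟩, rootsOfUnity.isCyclic R m⟩
  have : HasEnoughRootsOfUnity R (Monoid.exponent A) :=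
    HasEnoughRootsOfUnity.of_dvd R (Monoid.exponent_dvd_of_forall_pow_eq_one hA)
  have : Finite (A →* Rˣ) := .of_equiv A
    (CommGroup.monoidHom_mulEquiv_of_hasEnoughRootsOfUnity A R).some.symm.toEquiv
  have : Fintype (A →* Rˣ) := Fintype.ofFinite _
  have hcard : IsUnit (Nat.card A : R) := isUnit_natCard_of_pow_eq_one hu hA
  have hleft : fourierAdjoint R A ∘ₗ F.toLinearMap = (Nat.card A : R) • LinearMap.id := by
    refine MonoidAlgebra.lhom_ext' fun b => LinearMap.ext_ring ?_
    change fourierAdjoint R A (F (MonoidAlgebra.of R A b)) =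
      (Nat.card A : R) • MonoidAlgebra.of R A b
    simp only [fourierAdjoint_apply, hF, smul_smul, ← Finset.sum_smul, sum_char_apply_mul_inv,
      ite_smul, zero_smul, Finset.sum_ite_eq', Finset.mem_univ, if_true]
  have hright (f : (A →* Rˣ) → R) : F (fourierAdjoint R A f) = (Nat.card A : R) • f := by
    ext ψ
    simp only [fourierAdjoint_apply, map_sum, map_smul, Finset.sum_apply, Pi.smul_apply, hF,
      smul_eq_mul]
    rw [Finset.sum_comm]
    simp_rw [← Finset.mul_sum, mul_comm _ (ψ _ : R), sum_char_mul_inv_char]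
    simp [mul_comm]
  constructor
  · intro x y hxy
    have hx := LinearMap.congr_fun hleft x
    have hy := LinearMap.congr_fun hleft y
    simp only [LinearMap.comp_apply, AlgHom.toLinearMap_apply, LinearMap.smul_apply,
      LinearMap.id_apply] at hx hy
    exact hcard.smul_left_cancel.mp (by rw [← hx, ← hy, hxy])
  · intro f
    obtain ⟨u, hu⟩ := hcard
    refine ⟨(u⁻¹ : Rˣ).val • fourierAdjoint R A f, ?_⟩
    rw [map_smul, hright, ← hu, smul_smul, Units.inv_mul, one_smul]
end

section
/- Let p be a prime number and m a positive integer, and set k = φ(p^m − 1)/m, where φ is Euler's totient function. Then there is a ring isomorphism between ℤ_p[X]/(Φ_{p^m − 1}) and the product of k copies of the ring W(𝔽_{p^m}) of p-typical Witt vectors of the field with p^m elements. -/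
open Polynomial IsLocalRing UniqueFactorizationMonoid

theorem IsPrecomplete.of_surjective {R M N : Type*} [CommRing R] (I : Ideal R) [AddCommGroup M]
    [Module R M] [AddCommGroup N] [Module R N] [IsPrecomplete I M] (f : M →ₗ[R] N)
    (hf : Function.Surjective f) : IsPrecomplete I N := by
  rw [← AdicCompletion.of_surjective_iff]
  intro y
  obtain ⟨x, rfl⟩ := AdicCompletion.map_surjective I hf y
  obtain ⟨x, rfl⟩ := AdicCompletion.of_surjective I M x
  exact ⟨f x, (AdicCompletion.map_of I f x).symm⟩

theorem Submodule.mem_smul_top_pi_iff {R ι : Type*} [CommRing R] [Finite ι] (I : Ideal R)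
    (x : ι → R) : x ∈ (I • ⊤ : Submodule R (ι → R)) ↔ ∀ i, x i ∈ I := by
  classical
  have := Fintype.ofFinite ι
  refine ⟨fun hx i => ?_, fun hx => ?_⟩
  · have := Submodule.mem_map_of_mem (f := LinearMap.proj (R := R) (φ := fun _ : ι => R) i) hx
    rw [Submodule.map_smul'', Submodule.map_top] at this
    exact Submodule.smul_le.2 (fun r hr n _ => I.mul_mem_right n hr) this
  · rw [pi_eq_sum_univ' x]
    exact Submodule.sum_mem _ fun i _ => Submodule.smul_mem_smul (hx i) trivial

theorem IsPrecomplete.pi {R ι : Type*} [CommRing R] [Finite ι] (I : Ideal R)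
    [IsPrecomplete I R] : IsPrecomplete I (ι → R) := by
  refine ⟨fun f hf => ?_⟩
  have key (i : ι) : ∃ L : R, ∀ n, f n i ≡ L [SMOD (I ^ n • ⊤ : Submodule R R)] := by
    refine IsPrecomplete.prec ‹_› fun {a b} hab => ?_
    have := hf hab
    rw [SModEq.sub_mem, Submodule.mem_smul_top_pi_iff] at this
    rw [SModEq.sub_mem]
    simpa using this i
  choose L hL using key
  refine ⟨L, fun n => ?_⟩
  rw [SModEq.sub_mem, Submodule.mem_smul_top_pi_iff]
  intro i
  have := hL i n
  rw [SModEq.sub_mem] at this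
  simpa using this

theorem IsPrecomplete.of_finite {R M : Type*} [CommRing R] (I : Ideal R) [IsPrecomplete I R]
    [AddCommGroup M] [Module R M] [Module.Finite R M] : IsPrecomplete I M := by
  obtain ⟨n, f, hf⟩ := Module.Finite.exists_fin' R M
  have := IsPrecomplete.pi (ι := Fin n) I
  exact IsPrecomplete.of_surjective I f hf

/-- A linear map that is bijective modulo `a` is bijective, provided the modules are sufficiently
complete and the target has no `a`-torsion. -/
theorem LinearMap.bijective_of_bijective_mod {R M N : Type*} [CommRing R] [AddCommGroup M]
    [Module R M] [AddCommGroup N] [Module R N] {a : R} [IsAdicComplete (Ideal.span {a}) M]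
    [IsHausdorff (Ideal.span {a}) N] (f : M →ₗ[R] N) (htors : ∀ y : N, a • y = 0 → y = 0)
    (hinj : ∀ x y, f x = a • y → ∃ x', x = a • x')
    (hsurj : ∀ y, ∃ x y', y = f x + a • y') : Function.Bijective f := by
  constructor
  · rw [injective_iff_map_eq_zero]
    intro x hx
    refine IsHausdorff.haus ‹IsAdicComplete (Ideal.span {a}) M›.toIsHausdorff x fun n => ?_
    have key (n : ℕ) : ∃ x', x = a ^ n • x' ∧ f x' = 0 := by
      induction n with
      | zero => exact ⟨x, by simp, hx⟩
      | succ n ih =>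
        obtain ⟨x', rfl, h0⟩ := ih
        obtain ⟨x'', rfl⟩ := hinj x' 0 (by simpa using h0)
        exact ⟨x'', by rw [smul_smul, pow_succ], htors _ (by simpa using h0)⟩
    obtain ⟨x', rfl, -⟩ := key n
    rw [SModEq.zero, Ideal.span_singleton_pow]
    exact Submodule.smul_mem_smul (Ideal.mem_span_singleton_self _) trivial
  · refine surjective_of_mkQ_comp_surjective (I := Ideal.span {a}) fun y => ?_
    obtain ⟨y, rfl⟩ := Submodule.mkQ_surjective _ y
    obtain ⟨x, y', rfl⟩ := hsurj y
    refine ⟨x, ?_⟩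
    rw [LinearMap.comp_apply, Submodule.mkQ_apply, Submodule.mkQ_apply, eq_comm,
      Submodule.Quotient.eq, add_sub_cancel_left]
    exact Submodule.smul_mem_smul (Ideal.mem_span_singleton_self _) trivial

theorem orderOf_unitOfCoprime_pow_sub_one {p m : ℕ} (hp : 1 < p) (hm : 0 < m)
    (h : p.Coprime (p ^ m - 1)) : orderOf (ZMod.unitOfCoprime p h) = m := by
  have hpm : 1 < p ^ m := Nat.one_lt_pow hm.ne' hp
  have key (j : ℕ) : ZMod.unitOfCoprime p h ^ j = 1 ↔ p ^ m - 1 ∣ p ^ j - 1 := by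
    rw [← Nat.modEq_iff_dvd' (Nat.one_le_pow _ _ (by omega)), ← ZMod.natCast_eq_natCast_iff,
      Units.ext_iff]
    simp [eq_comm]
  rw [orderOf_eq_iff hm]
  refine ⟨(key m).2 dvd_rfl, fun j hj hj0 h1 => ?_⟩
  have h2 : p ^ j < p ^ m := Nat.pow_lt_pow_right hp hj
  have h3 : 1 < p ^ j := Nat.one_lt_pow hj0.ne' hp
  have := Nat.le_of_dvd (by omega) ((key j).1 h1)
  omega

theorem Polynomial.card_normalizedFactors_cyclotomic_pow_sub_one (p : ℕ) [Fact p.Prime] {m : ℕ}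
    (hm : 0 < m) :
    (normalizedFactors (cyclotomic (p ^ m - 1) (ZMod p))).toFinset.card =
      (p ^ m - 1).totient / m := by
  have hp : p.Prime := Fact.out
  have hpm : 1 < p ^ m := Nat.one_lt_pow hm.ne' hp.one_lt
  have hn : p.Coprime (p ^ m - 1) := by
    refine hp.coprime_iff_not_dvd.2 fun h => ?_
    have := (Nat.dvd_sub_iff_right hpm.le (dvd_pow_self p hm.ne')).1 h
    exact hp.one_lt.ne' (Nat.dvd_one.1 this)
  have := normalizedFactors_cyclotomic_card (K := ZMod p) (p := p) (f := 1) (by simp) hn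
  simpa [orderOf_unitOfCoprime_pow_sub_one hp.one_lt hm hn] using this

theorem exists_aeval_eq_zero_of_dvd_X_pow_card_sub_X {F K : Type*} [Field F] [Field K] [Finite K]
    [Algebra F K] {g : F[X]} (hg : Irreducible g) (hdvd : g ∣ X ^ Nat.card K - X) :
    ∃ x : K, aeval x g = 0 := by
  have h0 : (X ^ Nat.card K - X : K[X]) ≠ 0 :=
    FiniteField.X_pow_card_sub_X_ne_zero K Finite.one_lt_card
  have h := (splits_X_pow_nat_card_sub_X (K := K)).of_dvd h0
    (by simpa using Polynomial.map_dvd (algebraMap F K) hdvd)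
  obtain ⟨x, hx⟩ := h.exists_eval_eq_zero (by simpa using hg.degree_pos.ne')
  exact ⟨x, by rwa [aeval_def, ← eval_map]⟩

theorem IsPrimitiveRoot.aeval_surjective {F K : Type*} [Field F] [Field K] [Finite K]
    [Algebra F K] {ζ : K} (hζ : IsPrimitiveRoot ζ (Nat.card K - 1)) :
    Function.Surjective (aeval ζ : F[X] →ₐ[F] K) := by
  intro y
  have := Fintype.ofFinite K
  have : NeZero (Nat.card K - 1) := ⟨by have := Finite.one_lt_card (α := K); omega⟩
  by_cases hy : y = 0
  · exact ⟨0, by simp [hy]⟩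
  · obtain ⟨i, -, rfl⟩ := hζ.eq_pow_of_pow_eq_one
      (by rw [Nat.card_eq_fintype_card]; exact FiniteField.pow_card_sub_one_eq_one y hy)
    exact ⟨X ^ i, by simp⟩

theorem exists_primitiveRoots_separating (p : ℕ) [Fact p.Prime] {m : ℕ} (hm : 0 < m) :
    ∃ ζ : Fin ((p ^ m - 1).totient / m) → GaloisField p m,
      (∀ i, IsPrimitiveRoot (ζ i) (p ^ m - 1)) ∧
      (∀ P : (ZMod p)[X], (∀ i, aeval (ζ i) P = 0) → cyclotomic (p ^ m - 1) (ZMod p) ∣ P) ∧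
      ∀ y : Fin ((p ^ m - 1).totient / m) → GaloisField p m,
        ∃ P : (ZMod p)[X], ∀ i, aeval (ζ i) P = y i := by
  have hp : p.Prime := Fact.out
  have hpm : 1 < p ^ m := Nat.one_lt_pow hm.ne' hp.one_lt
  have hcard : Nat.card (GaloisField p m) = p ^ m := GaloisField.card p m hm.ne'
  have hnp : ¬ p ∣ p ^ m - 1 := fun h =>
    hp.one_lt.ne' (Nat.dvd_one.1 ((Nat.dvd_sub_iff_right hpm.le (dvd_pow_self p hm.ne')).1 h))
  have hne (F : Type) [Field F] [CharP F p] : NeZero ((p ^ m - 1 : ℕ) : F) :=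
    ⟨by rwa [Ne, CharP.cast_eq_zero_iff F p]⟩
  set n := p ^ m - 1 with hn
  have := hne (ZMod p)
  have := hne (GaloisField p m)
  set Φ := cyclotomic n (ZMod p) with hΦ
  have hΦ0 : Φ ≠ 0 := cyclotomic_ne_zero n _
  let S := (normalizedFactors Φ).toFinset
  have hS : Fintype.card S = n.totient / m := by
    rw [Fintype.card_coe]
    exact card_normalizedFactors_cyclotomic_pow_sub_one p hm
  let e : Fin (n.totient / m) ≃ S := (Fintype.equivFinOfCardEq hS).symm
  let g (i : Fin (n.totient / m)) : (ZMod p)[X] := (e i).1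
  have hgmem (i) : g i ∈ normalizedFactors Φ := Multiset.mem_toFinset.1 (e i).2
  have hirr (i) : Irreducible (g i) := irreducible_of_normalized_factor _ (hgmem i)
  have hdvd (i) : g i ∣ Φ := dvd_of_mem_normalizedFactors (hgmem i)
  have hcop : Pairwise (Function.onFun IsCoprime g) := by
    intro i j hij
    refine (hirr i).coprime_iff_not_dvd.2 fun h => hij (e.injective ?_)
    apply Subtype.ext
    have := ((hirr i).associated_of_dvd (hirr j) h)
    exact this.eq_of_normalized (normalize_normalized_factor _ (hgmem i))
      (normalize_normalized_factor _ (hgmem j))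
  have hprod : Φ ∣ ∏ i, g i := by
    have hnodup : (normalizedFactors Φ).Nodup :=
      (squarefree_iff_nodup_normalizedFactors hΦ0).1 (squarefree_cyclotomic n (ZMod p))
    have h1 : ∏ i, g i = (normalizedFactors Φ).prod := by
      rw [e.prod_comp (fun s : S => s.1), Finset.prod_coe_sort S (fun x => x)]
      simp only [S, Finset.prod, Multiset.toFinset_val, hnodup.dedup, Multiset.map_id']
    rw [h1]
    exact (prod_normalizedFactors hΦ0).symm.dvd
  have hX (i) : g i ∣ X ^ Nat.card (GaloisField p m) - X := by
    refine ((hdvd i).trans (cyclotomic.dvd_X_pow_sub_one n (ZMod p))).trans ⟨X, ?_⟩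
    rw [hcard, sub_mul, ← pow_succ, one_mul, hn, Nat.sub_add_cancel hpm.le]
  choose ζ hζ using fun i => exists_aeval_eq_zero_of_dvd_X_pow_card_sub_X (hirr i) (hX i)
  have hprim (i) : IsPrimitiveRoot (ζ i) n := by
    rw [← isRoot_cyclotomic_iff, ← map_cyclotomic n (algebraMap (ZMod p) _), IsRoot.def,
      eval_map_algebraMap]
    obtain ⟨q, hq⟩ := hdvd i
    rw [← hΦ, hq, map_mul, hζ, zero_mul]
  refine ⟨ζ, hprim, fun P hP => hprod.trans ?_, fun y => ?_⟩
  · refine Fintype.prod_dvd_of_coprime hcop fun i => ?_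
    exact ((minpoly.irreducible (Algebra.IsIntegral.isIntegral _)).dvd_symm (hirr i)
      (minpoly.dvd _ _ (hζ i))).trans (minpoly.dvd _ _ (hP i))
  · choose c hc using fun i =>
      IsPrimitiveRoot.aeval_surjective (F := ZMod p) (by rw [hcard]; exact hprim i) (y i)
    obtain ⟨P, hP⟩ := Ideal.exists_forall_sub_mem_ideal (I := fun i => Ideal.span {g i})
      (fun i j hij => (Ideal.isCoprime_span_singleton_iff _ _).2 (hcop hij)) c
    refine ⟨P, fun i => ?_⟩
    obtain ⟨q, hq⟩ := Ideal.mem_span_singleton.1 (hP i)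
    rw [← hc, ← sub_eq_zero, ← map_sub, hq, map_mul, hζ, zero_mul]

namespace WittVector

variable {p : ℕ} [Fact p.Prime] {K : Type*} [Field K] [CharP K p]

theorem constantCoeff_apply_padicInt [Algebra (ZMod p) K] (φ : ℤ_[p] →+* WittVector p K)
    (x : ℤ_[p]) :
    constantCoeff (φ x) = algebraMap (ZMod p) K (PadicInt.toZMod x) := by
  obtain ⟨y, hy⟩ : (p : ℤ_[p]) ∣ x - x.zmodRepr := by
    rw [← Ideal.mem_span_singleton, ← PadicInt.maximalIdeal_eq_span_p]
    exact PadicInt.sub_zmodRepr_mem x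
  rw [sub_eq_iff_eq_add] at hy
  rw [hy]
  simp only [map_add, map_mul, map_natCast, CharP.cast_eq_zero, zero_mul, zero_add]

theorem constantCoeff_aeval_padicInt [Algebra (ZMod p) K] [Algebra ℤ_[p] (WittVector p K)]
    (P : ℤ_[p][X]) (w : WittVector p K) :
    constantCoeff (aeval w P) = aeval (constantCoeff w) (P.map PadicInt.toZMod) := by
  rw [aeval_def, hom_eval₂, aeval_def, eval₂_map]
  congr 1
  ext x
  exact constantCoeff_apply_padicInt _ x

theorem exists_eq_p_mul_of_constantCoeff_eq_zero [PerfectRing K p] {w : WittVector p K}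
    (hw : constantCoeff w = 0) : ∃ y, w = p * y :=
  Ideal.mem_span_singleton.1 ((mem_span_p_iff_coeff_zero_eq_zero w).2 hw)

theorem isHausdorff_padicInt_pi [PerfectRing K p] [Algebra ℤ_[p] (WittVector p K)] (ι : Type*) :
    IsHausdorff (Ideal.span {(p : ℤ_[p])}) (ι → WittVector p K) := by
  refine ⟨fun x hx => ?_⟩
  ext i n
  have h := hx (n + 1)
  rw [SModEq.zero, Ideal.span_singleton_pow, Submodule.ideal_span_singleton_smul,
    Submodule.mem_smul_pointwise_iff_exists] at h
  obtain ⟨y, -, rfl⟩ := h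
  have := (mem_span_p_pow_iff_le_coeff_eq_zero ((p : WittVector p K) ^ (n + 1) * y i) (n + 1)).1
    (Ideal.mem_span_singleton.2 (dvd_mul_right _ _)) n n.lt_succ_self
  simpa [Algebra.smul_def] using this

end WittVector

theorem Polynomial.exists_eq_C_mul_add_of_map_toZMod_dvd {p : ℕ} [Fact p.Prime]
    {P Q : ℤ_[p][X]} (h : Q.map PadicInt.toZMod ∣ P.map PadicInt.toZMod) :
    ∃ A B : ℤ_[p][X], P = Q * A + C (p : ℤ_[p]) * B := by
  obtain ⟨a, ha⟩ := h
  obtain ⟨A, rfl⟩ := map_surjective PadicInt.toZMod (ZMod.ringHom_surjective _) a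
  have h0 : P - Q * A ∈ RingHom.ker (mapRingHom (PadicInt.toZMod (p := p))) := by
    simp [RingHom.mem_ker, ha]
  rw [ker_mapRingHom, PadicInt.ker_toZMod, PadicInt.maximalIdeal_eq_span_p, Ideal.map_span,
    Set.image_singleton, Ideal.mem_span_singleton] at h0
  obtain ⟨B, hB⟩ := h0
  exact ⟨A, B, by rw [← hB]; ring⟩

/-- The cyclotomic extension `ℤ_p[X]/(Φ_{p^m − 1})` splits as a product of
`φ(p^m − 1)/m` copies of the Witt vectors `W(𝔽_{p^m})`. -/
theorem cyclotomic_quotient_iso_wittVector_pi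
    (p : ℕ) [Fact p.Prime] (m : ℕ) (hm : 0 < m) :
    Nonempty
      ((Polynomial ℤ_[p] ⧸ Ideal.span {Polynomial.cyclotomic (p ^ m - 1) ℤ_[p]}) ≃+*
        (Fin ((p ^ m - 1).totient / m) → WittVector p (GaloisField p m))) := by
  have hn : 0 < p ^ m - 1 :=
    Nat.sub_pos_of_lt (Nat.one_lt_pow hm.ne' (Fact.out : p.Prime).one_lt)
  obtain ⟨ζ, hprim, hdvd, hsurj⟩ := exists_primitiveRoots_separating p hm
  generalize p ^ m - 1 = n at *
  let _ : Algebra ℤ_[p] (WittVector p (GaloisField p m)) :=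
    ((WittVector.map (algebraMap (ZMod p) (GaloisField p m))).comp
      (WittVector.fromPadicInt p)).toAlgebra
  let Φ := cyclotomic n ℤ_[p]
  let w (i : Fin (n.totient / m)) : WittVector p (GaloisField p m) :=
    WittVector.teichmuller p (ζ i)
  have hw (i) : IsPrimitiveRoot (w i) n := by
    refine (hprim i).map_of_injective (f := WittVector.teichmuller p) fun a b h => ?_
    simpa using congrArg (fun x : WittVector p (GaloisField p m) => x.coeff 0) h
  have hΦw : aeval w Φ = 0 := by
    funext i
    rw [← Pi.evalAlgHom_apply ℤ_[p] (fun _ => WittVector p (GaloisField p m)) i (aeval w Φ),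
      ← aeval_algHom_apply, Pi.evalAlgHom_apply, aeval_def, ← eval_map, map_cyclotomic]
    exact (hw i).isRoot_cyclotomic hn
  have hmon : Φ.Monic := cyclotomic.monic n _
  have := hmon.finite_adjoinRoot
  let f : AdjoinRoot Φ →ₐ[ℤ_[p]] (Fin (n.totient / m) → WittVector p (GaloisField p m)) :=
    AdjoinRoot.liftAlgHom Φ (Algebra.ofId _ _) w hΦw
  have hf (P : ℤ_[p][X]) (i) : f (AdjoinRoot.mk Φ P) i = aeval (w i) P := by
    rw [← Pi.evalAlgHom_apply ℤ_[p] (fun _ => WittVector p (GaloisField p m)) i w,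
      aeval_algHom_apply, Pi.evalAlgHom_apply]
    rfl
  have hcoeff (P : ℤ_[p][X]) (i) : WittVector.constantCoeff (f (AdjoinRoot.mk Φ P) i) =
      aeval (ζ i) (P.map PadicInt.toZMod) := by
    rw [hf, WittVector.constantCoeff_aeval_padicInt]
    congr 2
  have : IsAdicComplete (Ideal.span {(p : ℤ_[p])}) (AdjoinRoot Φ) := by
    rw [← PadicInt.maximalIdeal_eq_span_p]
    have := IsPrecomplete.of_finite (M := AdjoinRoot Φ) (maximalIdeal ℤ_[p])
    constructor
  have := WittVector.isHausdorff_padicInt_pi (p := p) (K := GaloisField p m)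
    (Fin (n.totient / m))
  have hsmul (y : Fin (n.totient / m) → WittVector p (GaloisField p m)) (i) :
      ((p : ℤ_[p]) • y) i = p * y i := by simp [Algebra.smul_def]
  have hbij : Function.Bijective f := by
    refine f.toLinearMap.bijective_of_bijective_mod (a := (p : ℤ_[p])) (fun y hy => ?_)
      (fun x y hxy => ?_) fun y => ?_
    · funext i
      have := hsmul y i
      rw [hy] at this
      exact WittVector.eq_zero_of_p_mul_eq_zero _ (by rw [mul_comm, ← this]; rfl)
    · obtain ⟨P, rfl⟩ := AdjoinRoot.mk_surjective x
      obtain ⟨A, B, rfl⟩ := exists_eq_C_mul_add_of_map_toZMod_dvd (P := P) (Q := Φ) (by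
        rw [map_cyclotomic]
        refine hdvd _ fun i => ?_
        rw [← hcoeff]
        have : f (AdjoinRoot.mk Φ P) i = p * y i := by rw [← hsmul, ← hxy]; rfl
        rw [this, map_mul, map_natCast, CharP.cast_eq_zero, zero_mul])
      refine ⟨AdjoinRoot.mk Φ B, ?_⟩
      simp [Algebra.smul_def]
    · obtain ⟨Q, hQ⟩ := hsurj fun i => WittVector.constantCoeff (y i)
      obtain ⟨P, rfl⟩ := map_surjective PadicInt.toZMod (ZMod.ringHom_surjective _) Q
      choose z hz using fun i => WittVector.exists_eq_p_mul_of_constantCoeff_eq_zero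
        (w := y i - f (AdjoinRoot.mk Φ P) i) (by rw [map_sub, hcoeff, hQ, sub_self])
      refine ⟨AdjoinRoot.mk Φ P, z, ?_⟩
      funext i
      rw [Pi.add_apply, hsmul, ← hz]
      exact (add_sub_cancel _ _).symm
  exact ⟨RingEquiv.ofBijective f.toRingHom hbij⟩
end
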